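/- arXiv:math/0406312 — 5 statements merged into one kernel-verified Lean document; each statement's English description precedes it below -/
import Mathlib

section
/- The coefficients satisfy η_0 = −γ_0 and η_1 = γ_0² − 2γ_1. -/
open Filter Topology Finset

theorem analyticAt_tsum_mul_pow {a : ℕ → ℂ}
    (h : ∀ᶠ s in 𝓝[≠] (0 : ℂ), Summable fun m : ℕ => a m * s ^ m) :
    AnalyticAt ℂ (fun s : ℂ => ∑' m : ℕ, a m * s ^ m) 0 ∧
      HasDerivAt (fun s : ℂ => ∑' m : ℕ, a m * s ^ m) (a 1) 0 := by
  have hp : HasFPowerSeriesAt (fun s : ℂ => ∑' m : ℕ, a m * s ^ m)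
      (FormalMultilinearSeries.ofScalars ℂ a) 0 := by
    rw [hasFPowerSeriesAt_iff]
    rw [eventually_nhdsWithin_iff] at h
    filter_upwards [h] with s hs
    have hsum : Summable fun m : ℕ => a m * s ^ m := by
      rcases eq_or_ne s 0 with rfl | hne
      · exact (hasSum_single 0 fun m hm => by simp [hm]).summable
      · exact hs hne
    simpa [FormalMultilinearSeries.coeff_ofScalars, mul_comm] using hsum.hasSum
  refine ⟨hp.analyticAt, ?_⟩
  simpa [FormalMultilinearSeries.coeff_ofScalars] using hp.hasDerivAt

theorem tsum_mul_zero_pow (a : ℕ → ℂ) : ∑' m : ℕ, a m * (0 : ℂ) ^ m = a 0 := by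
  rw [tsum_eq_single 0 fun m hm => by simp [hm]]
  simp

theorem eta_zero_and_one (γ η : ℕ → ℂ)
    (hγ : ∀ᶠ s in 𝓝[≠] (0 : ℂ),
      HasSum (fun m : ℕ => γ m * s ^ m) (riemannZeta (s + 1) - 1 / s))
    (hη : ∀ᶠ s in 𝓝[≠] (0 : ℂ),
      HasSum (fun m : ℕ => η m * s ^ m)
        (-(deriv riemannZeta (s + 1)) / riemannZeta (s + 1) - 1 / s)) :
    η 0 = -γ 0 ∧ η 1 = γ 0 ^ 2 - 2 * γ 1 := by
  obtain ⟨hGa, hGd⟩ := analyticAt_tsum_mul_pow (hγ.mono fun _ h => h.summable)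
  obtain ⟨hEa, hEd⟩ := analyticAt_tsum_mul_pow (hη.mono fun _ h => h.summable)
  have hG0 := tsum_mul_zero_pow γ
  have hE0 := tsum_mul_zero_pow η
  replace hγ := hγ.mono fun _ h => h.tsum_eq
  replace hη := hη.mono fun _ h => h.tsum_eq
  set G : ℂ → ℂ := fun s => ∑' m : ℕ, γ m * s ^ m
  set E : ℂ → ℂ := fun s => ∑' m : ℕ, η m * s ^ m
  change G 0 = γ 0 at hG0
  change E 0 = η 0 at hE0
  change ∀ᶠ s in 𝓝[≠] (0 : ℂ), G s = _ at hγ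
  change ∀ᶠ s in 𝓝[≠] (0 : ℂ), E s = _ at hη
  have hne : ∀ᶠ s in 𝓝[≠] (0 : ℂ), 1 + s * G s ≠ 0 := by
    have hc : ContinuousAt (fun s => 1 + s * G s) 0 :=
      continuousAt_const.add (continuousAt_id.mul hGa.continuousAt)
    exact (hc.eventually_ne (by simp)).filter_mono nhdsWithin_le_nhds
  set F : ℂ → ℂ := fun s => E s + G s + s * (E s * G s + deriv G s)
  have hF : ∀ᶠ s in 𝓝[≠] (0 : ℂ), F s = 0 := by
    filter_upwards [eventually_eventually_nhdsWithin.2 hγ, hγ, hη, hne, self_mem_nhdsWithin,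
      hGa.eventually_analyticAt.filter_mono nhdsWithin_le_nhds] with s hs hGs' hEs hs1 hs0 hGs
    have hs0 : s ≠ 0 := hs0
    have hz : riemannZeta (s + 1) = G s + 1 / s := by
      rw [hGs']; ring
    have hd : deriv riemannZeta (s + 1) = deriv G s - 1 / s ^ 2 := by
      have hs' : ∀ᶠ t in 𝓝 s, riemannZeta (t + 1) = G t + t⁻¹ := by
        rw [IsOpen.nhdsWithin_eq isOpen_compl_singleton hs0] at hs
        filter_upwards [hs] with t ht
        rw [ht]; ring
      rw [← deriv_comp_add_const, EventuallyEq.deriv_eq hs',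
        (hGs.differentiableAt.hasDerivAt.fun_add (hasDerivAt_inv hs0)).deriv]
      ring
    have hz1 : G s + 1 / s ≠ 0 := by
      intro h
      apply hs1
      field_simp at h
      linear_combination h
    rw [hz, hd] at hEs
    have key : (E s + 1 / s) * (G s + 1 / s) = -(deriv G s - 1 / s ^ 2) := by
      rw [hEs, sub_add_cancel, div_mul_cancel₀ _ hz1]
    field_simp at key
    apply mul_left_cancel₀ hs0
    simp only [F]
    linear_combination key
  have hFd : HasDerivAt F (η 1 + γ 1 + (η 0 * γ 0 + γ 1)) 0 := by
    have h1 := (hEa.differentiableAt.mul hGa.differentiableAt).add hGa.deriv.differentiableAt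
    have h2 := (hEd.add hGd).add ((hasDerivAt_id (0 : ℂ)).mul h1.hasDerivAt)
    refine h2.congr_deriv ?_
    simp [hG0, hE0, hGd.deriv]
  have hF0 : F 0 = 0 := tendsto_nhds_unique
    (hFd.continuousAt.tendsto.mono_left nhdsWithin_le_nhds)
    (tendsto_const_nhds.congr' (hF.mono fun _ h => h.symm))
  have hFe : F =ᶠ[𝓝 0] fun _ => 0 := by
    rw [eventually_nhdsWithin_iff] at hF
    filter_upwards [hF] with s hs
    rcases eq_or_ne s 0 with rfl | h
    · exact hF0
    · exact hs h
  have hFd0 := hFd.unique ((hasDerivAt_const (0 : ℂ) (0 : ℂ)).congr_of_eventuallyEq hFe)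
  have h0 : η 0 = -γ 0 := by
    simp only [F, hG0, hE0, zero_mul, add_zero] at hF0
    linear_combination hF0
  refine ⟨h0, ?_⟩
  rw [h0] at hFd0
  linear_combination hFd0
end

section
/- The coefficient η_2 satisfies η_2 = −γ_0³ + 3γ_0γ_1 − 3γ_2. -/
open Filter Topology Finset

/-- The sum of a power series near `0` is a Taylor polynomial plus `s ^ n` times an analytic
function. -/
theorem exists_analyticAt_eq_sum_range_add_pow_mul {a : ℕ → ℂ} {f : ℂ → ℂ}
    (h : ∀ᶠ s in 𝓝[≠] (0 : ℂ), HasSum (fun m : ℕ => a m * s ^ m) (f s)) (n : ℕ) :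
    ∃ R : ℂ → ℂ, AnalyticAt ℂ R 0 ∧
      ∀ᶠ s in 𝓝[≠] (0 : ℂ), f s = ∑ i ∈ range n, a i * s ^ i + s ^ n * R s := by
  have key : ∀ᶠ s in 𝓝[≠] (0 : ℂ), HasSum (fun m : ℕ => a (m + n) * s ^ m)
      ((f s - ∑ i ∈ range n, a i * s ^ i) / s ^ n) := by
    filter_upwards [h, self_mem_nhdsWithin] with s hs hs0
    have hs0 : s ≠ 0 := hs0
    refine (((hasSum_nat_add_iff' n).2 hs).div_const (s ^ n)).congr_fun fun m => ?_
    field_simp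
    ring
  refine ⟨fun s => ∑' m, a (m + n) * s ^ m, ?_, ?_⟩
  · refine ⟨FormalMultilinearSeries.ofScalars ℂ (fun m => a (m + n)), ?_⟩
    rw [hasFPowerSeriesAt_iff]
    rw [eventually_nhdsWithin_iff] at key
    filter_upwards [key] with s hs
    simp only [FormalMultilinearSeries.coeff_ofScalars, smul_eq_mul, zero_add]
    simp_rw [mul_comm (s ^ _)]
    refine Summable.hasSum ?_
    by_cases hs0 : s = 0
    · subst hs0
      exact summable_of_ne_finset_zero (s := {0}) fun m hm => by
        simp [Finset.mem_singleton.not.1 hm]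
    · exact (hs hs0).summable
  · filter_upwards [key, self_mem_nhdsWithin] with s hs hs0
    have hs0 : s ≠ 0 := hs0
    rw [hs.tsum_eq]
    field_simp
    ring

theorem eq_zero_of_eventually_add_mul_eq_zero {c : ℂ} {K : ℂ → ℂ} (hK : ContinuousAt K 0)
    (h : ∀ᶠ s in 𝓝[≠] (0 : ℂ), c + s * K s = 0) : c = 0 := by
  have hc : ContinuousAt (fun s => c + s * K s) 0 := by fun_prop
  have h1 : Tendsto (fun s => c + s * K s) (𝓝[≠] 0) (𝓝 c) := by
    simpa using hc.tendsto.mono_left nhdsWithin_le_nhds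
  exact tendsto_nhds_unique h1
    (tendsto_const_nhds.congr' (h.mono fun s hs => hs.symm))

theorem deriv_riemannZeta_eq_of_eventually_eq {G : ℂ → ℂ} (hG : AnalyticAt ℂ G 0)
    (h : ∀ᶠ s in 𝓝[≠] (0 : ℂ), riemannZeta (s + 1) - 1 / s = G s) :
    ∀ᶠ s in 𝓝[≠] (0 : ℂ), deriv riemannZeta (s + 1) = -1 / s ^ 2 + deriv G s := by
  have h' := eventually_eventually_nhdsWithin.2 h
  filter_upwards [h', self_mem_nhdsWithin, nhdsWithin_le_nhds hG.eventually_analyticAt]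
    with s hs hs0 hGs
  rw [isOpen_compl_singleton.nhdsWithin_eq hs0] at hs
  have hs0 : s ≠ 0 := hs0
  have h1 : HasDerivAt (fun t => riemannZeta (t + 1)) (deriv riemannZeta (s + 1)) s :=
    (differentiableAt_riemannZeta (by simpa using hs0)).hasDerivAt.comp_add_const s 1
  have h2 : HasDerivAt (fun t => t⁻¹ + G t) (-(s ^ 2)⁻¹ + deriv G s) s :=
    (hasDerivAt_inv hs0).add hGs.differentiableAt.hasDerivAt
  rw [h1.unique (h2.congr_of_eventuallyEq (hs.mono fun t ht => ?_))]
  · ring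
  · simp only [← ht]
    ring

theorem eta_two (γ η : ℕ → ℂ)
    (hγ : ∀ᶠ s in 𝓝[≠] (0 : ℂ),
      HasSum (fun m : ℕ => γ m * s ^ m) (riemannZeta (s + 1) - 1 / s))
    (hη : ∀ᶠ s in 𝓝[≠] (0 : ℂ),
      HasSum (fun m : ℕ => η m * s ^ m)
        (-(deriv riemannZeta (s + 1)) / riemannZeta (s + 1) - 1 / s)) :
    η 2 = -γ 0 ^ 3 + 3 * γ 0 * γ 1 - 3 * γ 2 := by
  obtain ⟨R, hR, hγR⟩ := exists_analyticAt_eq_sum_range_add_pow_mul hγ 3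
  obtain ⟨S, hS, hηS⟩ := exists_analyticAt_eq_sum_range_add_pow_mul hη 3
  simp only [sum_range_succ, sum_range_zero, zero_add, pow_zero, mul_one, pow_one] at hγR hηS
  have hderiv := deriv_riemannZeta_eq_of_eventually_eq (by fun_prop) hγR
  have hne : ∀ᶠ s in 𝓝[≠] (0 : ℂ), riemannZeta (s + 1) ≠ 0 := by
    have hc : ContinuousAt (fun s => 1 + s * (γ 0 + γ 1 * s + γ 2 * s ^ 2 + s ^ 3 * R s)) 0 := by
      have := hR.continuousAt
      fun_prop
    filter_upwards [hγR, self_mem_nhdsWithin,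
      nhdsWithin_le_nhds (hc.eventually_ne (y := 0) (by simp))] with s hs hs0 hs1 hz
    rw [← hs, hz] at hs1
    have hs0 : s ≠ 0 := hs0
    exact hs1 (by field_simp; ring)
  have hR' := hR.deriv
  have hRc := hR.continuousAt
  have hRc' := hR'.continuousAt
  have hSc := hS.continuousAt
  have main : ∀ᶠ s in 𝓝[≠] (0 : ℂ),
      (η 0 + γ 0) + s * ((η 1 + 2 * γ 1 + η 0 * γ 0) + s * ((η 2 + 3 * γ 2 + η 0 * γ 1 + η 1 * γ 0)
        + s * (S s + 4 * R s + s * deriv R s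
          + (η 0 * γ 2 + η 1 * γ 1 + η 2 * γ 0)
          + s * (η 0 * R s + η 1 * γ 2 + η 2 * γ 1 + S s * γ 0)
          + s ^ 2 * (η 1 * R s + η 2 * γ 2 + S s * γ 1)
          + s ^ 3 * (η 2 * R s + S s * γ 2) + s ^ 4 * (S s * R s)))) = 0 := by
    filter_upwards [hγR, hηS, hderiv, hne, self_mem_nhdsWithin,
      nhdsWithin_le_nhds hR.eventually_analyticAt] with s h1 h2 h3 h4 hs0 hRs
    have hs0 : s ≠ 0 := hs0
    have hd : deriv (fun s => γ 0 + γ 1 * s + γ 2 * s ^ 2 + s ^ 3 * R s) s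
        = γ 1 + 2 * γ 2 * s + 3 * s ^ 2 * R s + s ^ 3 * deriv R s := by
      refine HasDerivAt.deriv ?_
      have hRd := hRs.differentiableAt.hasDerivAt
      refine (((((hasDerivAt_id s).const_mul (γ 1)).const_add (γ 0)).add
        ((hasDerivAt_pow 2 s).const_mul (γ 2))).add ((hasDerivAt_pow 3 s).mul hRd)).congr_deriv ?_
      norm_num
      ring
    rw [hd] at h3
    rw [sub_eq_iff_eq_add] at h1 h2
    rw [div_eq_iff h4, h3, h1] at h2
    field_simp at h2
    refine mul_left_cancel₀ hs0 ?_
    linear_combination -h2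
  have e0 := eq_zero_of_eventually_add_mul_eq_zero (by fun_prop) main
  simp only [e0, zero_add] at main
  have main1 := main.and self_mem_nhdsWithin |>.mono
    fun s hs => (mul_eq_zero.1 hs.1).resolve_left hs.2
  have e1 := eq_zero_of_eventually_add_mul_eq_zero (by fun_prop) main1
  simp only [e1, zero_add] at main1
  have main2 := main1.and self_mem_nhdsWithin |>.mono
    fun s hs => (mul_eq_zero.1 hs.1).resolve_left hs.2
  have e2 := eq_zero_of_eventually_add_mul_eq_zero (by fun_prop) main2
  linear_combination e2 - γ 0 * e1 + (γ 0 ^ 2 - γ 1) * e0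
end

section
/- The coefficient η_4 satisfies η_4 = −γ_0⁵ + 5γ_0³γ_1 − 5γ_0γ_1² − 5γ_0²γ_2 + 5γ_1γ_2 + 5γ_0γ_3 − 5γ_4. -/
open Filter Topology Finset

/-- The Taylor coefficients at `0` of the sum of a convergent power series. -/
theorem analyticAt_and_iteratedDeriv_of_hasSum {a : ℕ → ℂ} {f : ℂ → ℂ}
    (hf : ∀ᶠ s in 𝓝 (0 : ℂ), HasSum (fun m : ℕ => a m * s ^ m) (f s)) :
    AnalyticAt ℂ f 0 ∧ ∀ n, iteratedDeriv n f 0 = n.factorial * a n := by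
  have hp : HasFPowerSeriesAt f (FormalMultilinearSeries.ofScalars ℂ a) 0 := by
    rw [hasFPowerSeriesAt_iff]
    filter_upwards [hf] with s hs
    simpa [FormalMultilinearSeries.coeff_ofScalars, mul_comm] using hs
  refine ⟨hp.analyticAt, fun n => ?_⟩
  have h := congrArg (fun p => p.coeff n)
    (hp.analyticAt.hasFPowerSeriesAt.eq_formalMultilinearSeries hp)
  simp only [FormalMultilinearSeries.coeff_ofScalars] at h
  rw [← h]
  field_simp [Nat.factorial_ne_zero]

/-- The sum of a power series, converging near `0`, extends the function it represents off `0`. -/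
theorem eventually_hasSum_tsum {a : ℕ → ℂ} {f : ℂ → ℂ}
    (hf : ∀ᶠ s in 𝓝[≠] (0 : ℂ), HasSum (fun m : ℕ => a m * s ^ m) (f s)) :
    ∀ᶠ s in 𝓝 (0 : ℂ), HasSum (fun m : ℕ => a m * s ^ m) (∑' m, a m * s ^ m) := by
  rw [eventually_nhdsWithin_iff] at hf
  filter_upwards [hf] with s hs
  by_cases h : s = 0
  · subst h
    refine (summable_of_ne_finset_zero (s := {0}) fun m hm => ?_).hasSum
    simp_all
  · exact (hs h).summable.hasSum

theorem iteratedDeriv_succ_id_mul_zero {f : ℂ → ℂ} (hf : AnalyticAt ℂ f 0) (n : ℕ) :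
    iteratedDeriv (n + 1) (fun s => s * f s) 0 = (n + 1) * iteratedDeriv n f 0 := by
  rw [iteratedDeriv_fun_mul contDiffAt_fun_id hf.contDiffAt, Finset.sum_eq_single 1]
  · simp
  · intro i _ hi
    simp [iteratedDeriv_fun_id_zero, hi]
  · simp

/-- If `1 / s + g s` has negative logarithmic derivative `1 / s + h s` off `0`, then
`(s g)' = -(h + s h g)`. -/
theorem eventually_deriv_id_mul_eq {F g h : ℂ → ℂ} (hg : AnalyticAt ℂ g 0) (hh : AnalyticAt ℂ h 0)
    (hF : ∀ᶠ s in 𝓝[≠] (0 : ℂ), F s - 1 / s = g s)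
    (hF' : ∀ᶠ s in 𝓝[≠] (0 : ℂ), -deriv F s / F s - 1 / s = h s) :
    deriv (fun s => s * g s) =ᶠ[𝓝 0] fun s => -(h s + s * (h s * g s)) := by
  have hsg : AnalyticAt ℂ (fun s => s * g s) 0 := analyticAt_id.mul hg
  have hne : ∀ᶠ s in 𝓝[≠] (0 : ℂ), 1 + s * g s ≠ 0 := by
    refine nhdsWithin_le_nhds ?_
    have hc : ContinuousAt (fun s => 1 + s * g s) 0 := continuousAt_const.add hsg.continuousAt
    exact hc.eventually_ne (by simp)
  have hev : ∀ᶠ s in 𝓝[≠] (0 : ℂ), F =ᶠ[𝓝 s] fun z => 1 / z + g z := by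
    filter_upwards [eventually_eventually_nhdsWithin.2 hF, self_mem_nhdsWithin] with s hs h0
    rw [(isOpen_compl_singleton (x := (0 : ℂ))).nhdsWithin_eq h0] at hs
    filter_upwards [hs] with z hz
    rw [← hz]; ring
  have hgd : ∀ᶠ s in 𝓝[≠] (0 : ℂ), DifferentiableAt ℂ g s :=
    nhdsWithin_le_nhds (hg.eventually_analyticAt.mono fun _ h => h.differentiableAt)
  refine ((hsg.deriv).frequently_eq_iff_eventually_eq
    (hh.add (analyticAt_id.mul (hh.mul hg))).neg).1 (Eventually.frequently ?_)
  filter_upwards [hne, hev, hgd, hF', self_mem_nhdsWithin] with s hs hFs hgs hhs h0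
  have h0 : s ≠ 0 := h0
  have hd : deriv F s = -1 / s ^ 2 + deriv g s := by
    rw [hFs.deriv_eq, deriv_fun_add (by fun_prop (disch := assumption)) hgs]
    simp [neg_div]
  have hd' : deriv (fun s => s * g s) s = g s + s * deriv g s := by
    rw [deriv_fun_mul differentiableAt_fun_id hgs]; simp
  have hF0 : F s = (1 + s * g s) / s := by rw [hFs.eq_of_nhds]; field_simp
  have hprod : -deriv F s = (h s + 1 / s) * F s := by
    have : F s ≠ 0 := hF0 ▸ div_ne_zero hs h0
    rw [← hhs]
    field_simp
    ring
  rw [hd, hF0] at hprod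
  field_simp at hprod
  rw [hd']
  simp only [Pi.neg_apply, Pi.add_apply, Pi.mul_apply, id]
  apply mul_left_cancel₀ h0
  linear_combination -hprod

theorem eta_four (γ η : ℕ → ℂ)
    (hγ : ∀ᶠ s in 𝓝[≠] (0 : ℂ),
      HasSum (fun m : ℕ => γ m * s ^ m) (riemannZeta (s + 1) - 1 / s))
    (hη : ∀ᶠ s in 𝓝[≠] (0 : ℂ),
      HasSum (fun m : ℕ => η m * s ^ m)
        (-(deriv riemannZeta (s + 1)) / riemannZeta (s + 1) - 1 / s)) :
    η 4 = -γ 0 ^ 5 + 5 * γ 0 ^ 3 * γ 1 - 5 * γ 0 * γ 1 ^ 2 - 5 * γ 0 ^ 2 * γ 2 + 5 * γ 1 * γ 2 + 5 * γ 0 * γ 3 - 5 * γ 4 := by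
  set g : ℂ → ℂ := fun s => ∑' m, γ m * s ^ m
  set h : ℂ → ℂ := fun s => ∑' m, η m * s ^ m
  obtain ⟨hg, hgn⟩ := analyticAt_and_iteratedDeriv_of_hasSum (f := g) (eventually_hasSum_tsum hγ)
  obtain ⟨hh, hhn⟩ := analyticAt_and_iteratedDeriv_of_hasSum (f := h) (eventually_hasSum_tsum hη)
  have hode := eventually_deriv_id_mul_eq (F := fun s => riemannZeta (s + 1)) hg hh
    (hγ.mono fun s hs => hs.tsum_eq.symm)
    (hη.mono fun s hs => by rw [deriv_comp_add_const]; exact hs.tsum_eq.symm)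
  have hs : AnalyticAt ℂ (fun s => s * (h s * g s)) 0 := analyticAt_id.mul (hh.mul hg)
  have key (n : ℕ) : iteratedDeriv (n + 1) (fun s => s * g s) 0 =
      -(iteratedDeriv n h 0 + iteratedDeriv n (fun s => s * (h s * g s)) 0) := by
    rw [iteratedDeriv_succ', hode.iteratedDeriv_eq, iteratedDeriv_fun_neg,
      iteratedDeriv_fun_add hh.contDiffAt hs.contDiffAt]
  have rec_zero : η 0 = -γ 0 := by
    have := key 0
    rw [iteratedDeriv_succ_id_mul_zero hg, hgn, hhn] at this
    simp at this
    rw [this, neg_neg]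
  have rec_succ (n : ℕ) : ((n + 1).factorial : ℂ) * η (n + 1) =
      -((n + 2) * ((n + 1).factorial * γ (n + 1))) - (n + 1) * ∑ i ∈ range (n + 1),
        (n.choose i : ℂ) * (i.factorial * η i) * ((n - i).factorial * γ (n - i)) := by
    have := key (n + 1)
    rw [iteratedDeriv_succ_id_mul_zero hg,
      iteratedDeriv_succ_id_mul_zero (f := fun s => h s * g s) (hh.mul hg),
      iteratedDeriv_fun_mul hh.contDiffAt hg.contDiffAt] at this
    simp only [hgn, hhn] at this
    push_cast at this ⊢
    linear_combination this
  have h1 := rec_succ 0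
  have h2 := rec_succ 1
  have h3 := rec_succ 2
  have h4 := rec_succ 3
  simp only [Finset.sum_range_succ, Nat.factorial, Nat.choose] at h1 h2 h3 h4
  norm_num at h1 h2 h3 h4
  have e2 : η 2 = -3 * γ 2 - (η 0 * γ 1 + η 1 * γ 0) := by linear_combination h2 / 2
  have e3 : η 3 = -4 * γ 3 - (η 0 * γ 2 + η 1 * γ 1 + η 2 * γ 0) := by
    linear_combination h3 / 6
  have e4 : η 4 = -5 * γ 4 - (η 0 * γ 3 + η 1 * γ 2 + η 2 * γ 1 + η 3 * γ 0) := by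
    linear_combination h4 / 24
  rw [e4, e3, e2, h1, rec_zero]
  ring
end

section
/- The Stieltjes constant γ_2 satisfies γ_2 = (1/3!)(−η_0³ + 3η_0η_1 − 2η_2). -/
open Filter Topology Finset

/-- A power series that converges near a point to `f` off that point comes from an analytic
function, whose iterated derivatives at the point are given by the coefficients. -/
theorem exists_analyticAt_of_eventually_hasSum {c : ℕ → ℂ} {f : ℂ → ℂ}
    (h : ∀ᶠ s in 𝓝[≠] (0 : ℂ), HasSum (fun m : ℕ => c m * s ^ m) (f s)) :
    ∃ g : ℂ → ℂ, AnalyticAt ℂ g 0 ∧ g =ᶠ[𝓝[≠] 0] f ∧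
      ∀ n, iteratedDeriv n g 0 = (n.factorial : ℂ) * c n := by
  have hp : HasFPowerSeriesAt (Function.update f 0 (c 0))
      (FormalMultilinearSeries.ofScalars ℂ c) 0 := by
    rw [hasFPowerSeriesAt_iff]
    filter_upwards [eventually_nhdsWithin_iff.mp h] with s hs
    rcases eq_or_ne s 0 with rfl | hne
    · have h0 : HasSum (fun m : ℕ => c m * (0 : ℂ) ^ m) (c 0 * 0 ^ 0) :=
        hasSum_single 0 fun m hm => by simp [hm]
      simpa [FormalMultilinearSeries.coeff_ofScalars, mul_comm] using h0
    · simpa [FormalMultilinearSeries.coeff_ofScalars, mul_comm, hne] using hs hne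
  refine ⟨_, hp.analyticAt, ?_, fun n => ?_⟩
  · filter_upwards [self_mem_nhdsWithin] with s hs
    exact Function.update_of_ne hs _ _
  · obtain ⟨r, hr⟩ := hp
    have := hr.factorial_smul 1 n
    rw [← iteratedDeriv_eq_iteratedFDeriv] at this
    rw [← this]
    simp [FormalMultilinearSeries.apply_eq_prod_smul_coeff,
      FormalMultilinearSeries.coeff_ofScalars]

theorem gamma_two (γ η : ℕ → ℂ)
    (hγ : ∀ᶠ s in 𝓝[≠] (0 : ℂ),
      HasSum (fun m : ℕ => γ m * s ^ m) (riemannZeta (s + 1) - 1 / s))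
    (hη : ∀ᶠ s in 𝓝[≠] (0 : ℂ),
      HasSum (fun m : ℕ => η m * s ^ m)
        (-(deriv riemannZeta (s + 1)) / riemannZeta (s + 1) - 1 / s)) :
    γ 2 = (1 / ((Nat.factorial 3 : ℕ) : ℂ)) * (-η 0 ^ 3 + 3 * η 0 * η 1 - 2 * η 2) := by
  obtain ⟨c, hc0, hc⟩ : ∃ c : ℕ → ℂ, c 0 = 1 ∧ ∀ n, c (n + 1) = γ n :=
    ⟨fun n => Nat.casesOn n 1 γ, rfl, fun _ => rfl⟩
  have hγ' : ∀ᶠ s in 𝓝[≠] (0 : ℂ),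
      HasSum (fun m : ℕ => c m * s ^ m) (s * riemannZeta (s + 1)) := by
    filter_upwards [hγ, self_mem_nhdsWithin] with s hs hne
    have hne : s ≠ 0 := hne
    rw [← hasSum_nat_add_iff' 1]
    convert! hs.mul_left s using 1
    · ext m
      simp only [hc, pow_succ]
      ring
    · rw [sum_range_one, hc0]
      field_simp
  obtain ⟨F, hF, hFζ, hFc⟩ := exists_analyticAt_of_eventually_hasSum hγ'
  obtain ⟨E, hE, hEζ, hEc⟩ := exists_analyticAt_of_eventually_hasSum hη
  have hF0 : F 0 = 1 := by simpa [hc0] using hFc 0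
  have hF_ne : ∀ᶠ s in 𝓝[≠] (0 : ℂ), F s ≠ 0 :=
    (hF.continuousAt.eventually_ne (by simp [hF0])).filter_mono nhdsWithin_le_nhds
  have hode : deriv F =ᶠ[𝓝[≠] 0] fun s => -(F s * E s) := by
    filter_upwards [hFζ, hEζ, hF_ne, eventually_eventually_nhdsWithin.mpr hFζ, self_mem_nhdsWithin]
      with s hFs hEs hFne hFnhds hne
    have hne : s ≠ 0 := hne
    rw [isOpen_compl_singleton.nhdsWithin_eq hne] at hFnhds
    have hζ : riemannZeta (s + 1) ≠ 0 := fun h => hFne (by simp [hFs, h])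
    have hd : HasDerivAt (fun z => riemannZeta (z + 1)) (deriv riemannZeta (s + 1)) s :=
      (differentiableAt_riemannZeta (by simpa using hne)).hasDerivAt.comp_add_const s 1
    rw [EventuallyEq.deriv_eq hFnhds, ((hasDerivAt_id' s).fun_mul hd).deriv, hFs, hEs]
    field_simp
    ring
  replace hode : deriv F =ᶠ[𝓝 0] fun s => -(F s * E s) :=
    (hF.deriv.continuousAt.eventuallyEq_nhds_iff_eventuallyEq_nhdsNE
      (hF.mul hE).neg.continuousAt).mp hode
  have hrec (n : ℕ) : iteratedDeriv (n + 1) F 0 =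
      -∑ i ∈ range (n + 1), (n.choose i : ℂ) * iteratedDeriv i F 0 *
        iteratedDeriv (n - i) E 0 := by
    rw [iteratedDeriv_succ', hode.iteratedDeriv_eq n, iteratedDeriv_fun_neg,
      iteratedDeriv_fun_mul hF.contDiffAt hE.contDiffAt]
  simp only [hFc, hEc] at hrec
  have h0 := hrec 0
  have h1 := hrec 1
  have h2 := hrec 2
  norm_num [sum_range_succ, Nat.factorial, hc0, show c 1 = γ 0 from hc 0,
    show c 2 = γ 1 from hc 1, show c 3 = γ 2 from hc 2] at h0 h1 h2 ⊢
  linear_combination h2 / 6 - (η 0 / 6) * h1 - (η 1 / 3 - η 0 ^ 2 / 6) * h0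
end

section
/- The Stieltjes constant γ_3 satisfies γ_3 = (1/4!)(η_0⁴ − 6η_0²η_1 + 3η_1² + 8η_0η_2 − 6η_3). -/
open Filter Topology Finset

/-- A power series converging on a punctured neighbourhood of `0` is the Taylor series of an
analytic function. -/
lemma exists_analyticAt_iteratedDeriv_of_hasSum {a : ℕ → ℂ} {f : ℂ → ℂ}
    (h : ∀ᶠ s in 𝓝[≠] (0 : ℂ), HasSum (fun m : ℕ => a m * s ^ m) (f s)) :
    ∃ g : ℂ → ℂ, AnalyticAt ℂ g 0 ∧ f =ᶠ[𝓝[≠] 0] g ∧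
      ∀ n, iteratedDeriv n g 0 = (n.factorial : ℂ) * a n := by
  have hp : HasFPowerSeriesAt (fun s => ∑' m, a m * s ^ m)
      (FormalMultilinearSeries.ofScalars ℂ a) 0 := by
    rw [hasFPowerSeriesAt_iff]
    filter_upwards [eventually_nhdsWithin_iff.1 h] with s hs
    simp only [FormalMultilinearSeries.coeff_ofScalars, smul_eq_mul, zero_add, mul_comm (s ^ _)]
    rcases eq_or_ne s 0 with rfl | hne
    · exact (summable_of_ne_finset_zero (s := {0}) fun b hb => by
        simp_all).hasSum
    · exact (hs hne).summable.hasSum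
  refine ⟨_, hp.analyticAt, ?_, fun n => ?_⟩
  · filter_upwards [h] with s hs using hs.tsum_eq.symm
  · have := congrArg (fun q => q.coeff n)
      (hp.eq_formalMultilinearSeries hp.analyticAt.hasFPowerSeriesAt)
    simp only [FormalMultilinearSeries.coeff_ofScalars] at this
    rw [this, mul_div_cancel₀ _ (Nat.cast_ne_zero.2 n.factorial_ne_zero)]

/-- The recursion between the Taylor coefficients of `f` and `h` when `f' = -(h f)`. -/
lemma iteratedDeriv_succ_of_deriv_eq_neg_mul {f h : ℂ → ℂ} (hf : AnalyticAt ℂ f 0)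
    (hh : AnalyticAt ℂ h 0) (e : deriv f =ᶠ[𝓝 0] -(h * f)) (n : ℕ) :
    iteratedDeriv (n + 1) f 0 =
      -∑ i ∈ range (n + 1), n.choose i * iteratedDeriv i h 0 * iteratedDeriv (n - i) f 0 := by
  rw [iteratedDeriv_succ', e.iteratedDeriv_eq, iteratedDeriv_neg,
    iteratedDeriv_mul hh.contDiffAt hf.contDiffAt]

theorem gamma_three (γ η : ℕ → ℂ)
    (hγ : ∀ᶠ s in 𝓝[≠] (0 : ℂ),
      HasSum (fun m : ℕ => γ m * s ^ m) (riemannZeta (s + 1) - 1 / s))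
    (hη : ∀ᶠ s in 𝓝[≠] (0 : ℂ),
      HasSum (fun m : ℕ => η m * s ^ m)
        (-(deriv riemannZeta (s + 1)) / riemannZeta (s + 1) - 1 / s)) :
    γ 3 = (1 / ((Nat.factorial 4 : ℕ) : ℂ)) * (η 0 ^ 4 - 6 * η 0 ^ 2 * η 1 + 3 * η 1 ^ 2 + 8 * η 0 * η 2 - 6 * η 3) := by
  have hF : ∀ᶠ s in 𝓝[≠] (0 : ℂ),
      HasSum (fun m : ℕ => (if m = 0 then 1 else γ (m - 1)) * s ^ m) (s * riemannZeta (s + 1)) := by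
    filter_upwards [hγ, self_mem_nhdsWithin] with s hs hne
    have hne : s ≠ 0 := hne
    rw [← hasSum_nat_add_iff' 1]
    convert! hs.mul_left s using 1
    · ext m
      simp only [Nat.add_eq_zero_iff, one_ne_zero, and_false, if_false, Nat.add_sub_cancel]
      ring
    · rw [sum_range_one, mul_sub, mul_one_div_cancel hne]
      simp
  obtain ⟨f, hfa, hfe, hfd⟩ := exists_analyticAt_iteratedDeriv_of_hasSum hF
  obtain ⟨h, hha, hhe, hhd⟩ := exists_analyticAt_iteratedDeriv_of_hasSum hη
  have hf0 : f 0 ≠ 0 := by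
    rw [← iteratedDeriv_zero (f := f), hfd 0]
    simp
  have hne0 : ∀ᶠ s in 𝓝[≠] (0 : ℂ), f s ≠ 0 :=
    (hfa.continuousAt.eventually_ne hf0).filter_mono nhdsWithin_le_nhds
  have e : deriv f =ᶠ[𝓝[≠] 0] -(h * f) := by
    filter_upwards [eventually_eventually_nhdsWithin.2 hfe, hfe, hhe, hne0, self_mem_nhdsWithin]
      with s hs hs' hh hn hne
    have hne : s ≠ 0 := hne
    rw [isOpen_compl_singleton.nhdsWithin_eq hne] at hs
    have hz : HasDerivAt riemannZeta (deriv riemannZeta (s + 1)) (s + 1) :=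
      (differentiableAt_riemannZeta (by simpa using hne)).hasDerivAt
    have hd := (hasDerivAt_id s).mul (hz.comp_add_const s 1)
    have hzne : riemannZeta (s + 1) ≠ 0 := fun h0 => hn (by rw [← hs', h0, mul_zero])
    rw [← EventuallyEq.deriv_eq hs, Pi.neg_apply, Pi.mul_apply, ← hh, ← hs']
    refine hd.deriv.trans ?_
    simp only [id]
    field_simp
    ring
  have e' := (hfa.deriv.continuousAt.eventuallyEq_nhds_iff_eventuallyEq_nhdsNE
    (hha.mul hfa).neg.continuousAt).1 e
  have r := iteratedDeriv_succ_of_deriv_eq_neg_mul hfa hha e'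
  have r0 := r 0
  have r1 := r 1
  have r2 := r 2
  have r3 := r 3
  simp only [hfd, hhd, sum_range_succ, sum_range_zero] at r0 r1 r2 r3
  norm_num [Nat.factorial, Nat.choose] at r0 r1 r2 r3 ⊢
  have g1 : γ 1 = (η 0 ^ 2 - η 1) / 2 := by
    rw [r0] at r1
    linear_combination r1 / 2
  have g2 : γ 2 = (-η 0 ^ 3 + 3 * η 0 * η 1 - 2 * η 2) / 6 := by
    rw [r0, g1] at r2
    linear_combination r2 / 6
  rw [r0, g1, g2] at r3
  linear_combination r3 / 24
end
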